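/- Fix M > 0. There exists a constant C > 0 such that for every l ∈ ℕ (with λ = l(l+1)), every T > 0, and every smooth function φ : [0, T] × ℝ → ℝ which solves the wave equation ∂_t²φ(t,x) = ∂_x²φ(t,x) − W_λ(x)·φ(t,x) and is, together with all its derivatives, Schwartz in x locally uniformly in t, the local decay estimate ∫_0^T ∫_ℝ ( φ(t,x)²/(1 + x²)² + (∂_x φ(t,x))²/(1 + x²) ) dx dt ≤ C · E holds, where E = (1/2)∫_ℝ ( (∂_t φ(0,x))² + (∂_x φ(0,x))² + W_λ(x)·φ(0,x)² ) dx is the initial energy; the constant C is independent of l, T and φ. -/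

import Mathlib

open MeasureTheory

/-- The tortoise coordinate normalised to vanish at `r = 3M`. -/
noncomputable def tortoise (M r : ℝ) : ℝ :=
  r + 2 * M * Real.log ((r - 2 * M) / (2 * M)) - 3 * M + 2 * M * Real.log 2

theorem hasDerivAt_tortoise {M r : ℝ} (hM : 0 < M) (hr : 2 * M < r) :
    HasDerivAt (tortoise M) (1 + 2 * M / (r - 2 * M)) r := by
  have h1 : HasDerivAt (fun r : ℝ => (r - 2 * M) / (2 * M)) (1 / (2 * M)) r :=
    ((hasDerivAt_id r).sub_const _).div_const _
  have hpos : 0 < r - 2 * M := by linarith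
  have h2 := ((((hasDerivAt_id r).add ((h1.log (by positivity)).const_mul (2 * M))).sub_const
    (3 * M)).add_const (2 * M * Real.log 2))
  refine h2.congr_deriv ?_
  field_simp

theorem tortoise_strictMonoOn {M : ℝ} (hM : 0 < M) :
    StrictMonoOn (tortoise M) (Set.Ioi (2 * M)) := by
  intro r hr s hs hrs
  have hr' : 0 < r - 2 * M := by simpa using hr
  have : Real.log ((r - 2 * M) / (2 * M)) < Real.log ((s - 2 * M) / (2 * M)) := by
    apply Real.log_lt_log (by positivity)
    gcongr
  unfold tortoise
  have := mul_lt_mul_of_pos_left this (show 0 < 2 * M by linarith)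
  linarith

section Inverse

variable {M : ℝ} {ρ : ℝ → ℝ}

theorem tortoise_inverse_strictMono (hM : 0 < M) (hρ1 : ∀ x, 2 * M < ρ x)
    (hρ2 : ∀ x, tortoise M (ρ x) = x) : StrictMono ρ := by
  intro x y hxy
  by_contra! h
  have := (tortoise_strictMonoOn hM).monotoneOn (hρ1 y) (hρ1 x) h
  rw [hρ2, hρ2] at this
  linarith

theorem tortoise_inverse_apply (hM : 0 < M) (hρ1 : ∀ x, 2 * M < ρ x)
    (hρ2 : ∀ x, tortoise M (ρ x) = x) {r : ℝ} (hr : 2 * M < r) : ρ (tortoise M r) = r :=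
  (tortoise_strictMonoOn hM).injOn (hρ1 _) hr (hρ2 _)

theorem hasDerivAt_tortoise_inverse (hM : 0 < M) (hρ1 : ∀ x, 2 * M < ρ x)
    (hρ2 : ∀ x, tortoise M (ρ x) = x) (x : ℝ) : HasDerivAt ρ (1 - 2 * M / ρ x) x := by
  have hcont : ContinuousAt ρ x := by
    apply continuousAt_of_monotoneOn_of_image_mem_nhds (s := Set.univ)
      ((tortoise_inverse_strictMono hM hρ1 hρ2).monotone.monotoneOn _) Filter.univ_mem
    filter_upwards [Ioi_mem_nhds (hρ1 x)] with r hr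
    exact ⟨tortoise M r, trivial, tortoise_inverse_apply hM hρ1 hρ2 hr⟩
  have hpos : 0 < ρ x - 2 * M := by linarith [hρ1 x]
  have h0 : 0 < ρ x := by linarith [hρ1 x]
  have := (hasDerivAt_tortoise hM (hρ1 x)).of_local_left_inverse hcont (by positivity)
    (Filter.Eventually.of_forall hρ2)
  refine this.congr_deriv ?_
  field_simp
  ring

end Inverse

/-- The effective potential as a function of the area radius. -/
noncomputable def potential (M lam r : ℝ) : ℝ :=
  (1 - 2 * M / r) * (2 * M / r ^ 3 + lam / r ^ 2)

/-- The tortoise derivative of the effective potential, as a function of the area radius. -/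
noncomputable def potentialDeriv (M lam r : ℝ) : ℝ :=
  -2 * (1 - 2 * M / r) * (lam * r * (r - 3 * M) + M * (3 * r - 8 * M)) / r ^ 5

theorem hasDerivAt_potential {M lam : ℝ} {ρ : ℝ → ℝ} {x : ℝ}
    (h : HasDerivAt ρ (1 - 2 * M / ρ x) x) (h0 : ρ x ≠ 0) :
    HasDerivAt (fun x => potential M lam (ρ x)) (potentialDeriv M lam (ρ x)) x := by
  have h1 := ((h.inv h0).const_mul (2 * M)).const_sub 1
  have h3 := ((h.fun_pow 3).inv (by positivity)).const_mul (2 * M)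
  have h2 := ((h.fun_pow 2).inv (by positivity)).const_mul lam
  have := h1.mul (h3.add h2)
  refine (this.congr_deriv ?_)
  simp only [potentialDeriv, Pi.inv_apply, Pi.add_apply]
  field_simp
  ring

theorem potentialDeriv_mono {M lam r : ℝ} (hM : 0 < M) (hl : 0 ≤ lam) (h2 : 2 * M < r)
    (h3 : r ≤ 3 * M) : potentialDeriv M 0 r ≤ potentialDeriv M lam r := by
  have h0 : 0 < r := by linarith
  have hd : 0 < 1 - 2 * M / r := by rw [sub_pos, div_lt_one h0]; exact h2
  unfold potentialDeriv
  have : 0 ≤ lam * r * (3 * M - r) := by have : 0 ≤ 3 * M - r := by linarith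
                                         positivity
  have := mul_nonneg hd.le this
  gcongr ?_ / _
  nlinarith

theorem potentialDeriv_anti {M lam r : ℝ} (hM : 0 < M) (hl : 0 ≤ lam)
    (h3 : 3 * M ≤ r) : potentialDeriv M lam r ≤ potentialDeriv M 0 r := by
  have h0 : 0 < r := by linarith
  have hd : 0 < 1 - 2 * M / r := by rw [sub_pos, div_lt_one h0]; linarith
  unfold potentialDeriv
  have : 0 ≤ lam * r * (r - 3 * M) := by have : 0 ≤ r - 3 * M := by linarith
                                         positivity
  have := mul_nonneg hd.le this
  gcongr ?_ / _
  nlinarith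

theorem exists_potential_peak {M lam : ℝ} (hM : 0 < M) (hl : 0 ≤ lam) :
    ∃ r₀ ∈ Set.Icc (8 / 3 * M) (3 * M), ∀ r, 2 * M < r →
      (r - r₀) * potentialDeriv M lam r ≤ 0 := by
  have hc : ContinuousOn (fun r => lam * r * (r - 3 * M) + M * (3 * r - 8 * M))
    (Set.Icc (8 / 3 * M) (3 * M)) := by fun_prop
  have := intermediate_value_Icc (by linarith) hc
  have h0 : (0 : ℝ) ∈ Set.Icc (lam * (8 / 3 * M) * ((8 / 3 * M) - 3 * M)
      + M * (3 * (8 / 3 * M) - 8 * M))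
      (lam * (3 * M) * ((3 * M) - 3 * M) + M * (3 * (3 * M) - 8 * M)) := by
    constructor
    · have := mul_nonneg hl (sq_nonneg M); nlinarith
    · nlinarith
  obtain ⟨r₀, hr₀, h⟩ := this h0
  refine ⟨r₀, hr₀, fun r hr => ?_⟩
  have hr0 : 0 < r := by linarith
  have hr00 : 0 < r₀ := by linarith [hr₀.1]
  have hd : 0 < 1 - 2 * M / r := by rw [sub_pos, div_lt_one hr0]; exact hr
  have key : (lam * r * (r - 3 * M) + M * (3 * r - 8 * M)) =
      (r - r₀) * (lam * r * r₀ + 8 * M ^ 2) / r₀ := by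
    rw [eq_div_iff hr00.ne']
    simp only at h
    linear_combination r * h
  have : (r - r₀) * potentialDeriv M lam r =
      -(2 * (1 - 2 * M / r) * ((r - r₀) ^ 2 * ((lam * r * r₀ + 8 * M ^ 2) / r₀)) / r ^ 5) := by
    rw [potentialDeriv, key]; ring
  rw [this, neg_nonpos]
  positivity

theorem potentialDeriv_zero_pos {M r : ℝ} (hM : 0 < M) (h2 : 2 * M < r) (h : r < 8 / 3 * M) :
    0 < potentialDeriv M 0 r := by
  have h0 : 0 < r := by linarith
  have hd : 0 < 1 - 2 * M / r := by rw [sub_pos, div_lt_one h0]; linarith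
  have : 0 < M * (8 * M - 3 * r) := mul_pos hM (by linarith)
  have e : potentialDeriv M 0 r = 2 * (1 - 2 * M / r) * (M * (8 * M - 3 * r)) / r ^ 5 := by
    unfold potentialDeriv; ring
  rw [e]; positivity

theorem potentialDeriv_zero_neg {M r : ℝ} (hM : 0 < M) (h : 8 / 3 * M < r) :
    potentialDeriv M 0 r < 0 := by
  have h0 : 0 < r := by linarith
  have hd : 0 < 1 - 2 * M / r := by rw [sub_pos, div_lt_one h0]; linarith
  have : 0 < M * (3 * r - 8 * M) := mul_pos hM (by linarith)
  have e : potentialDeriv M 0 r = -(2 * (1 - 2 * M / r) * (M * (3 * r - 8 * M)) / r ^ 5) := by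
    unfold potentialDeriv; ring
  rw [e, neg_lt_zero]; positivity

theorem abs_potential_le {M lam r : ℝ} (hM : 0 < M) (hl : 0 ≤ lam) (h2 : 2 * M < r) :
    |potential M lam r| ≤ 2 * M / (2 * M) ^ 3 + lam / (2 * M) ^ 2 := by
  have h0 : 0 < r := by linarith
  have hd : 0 < 1 - 2 * M / r := by rw [sub_pos, div_lt_one h0]; linarith
  have hd1 : 1 - 2 * M / r ≤ 1 := by have : 0 < 2 * M / r := by positivity
                                     linarith
  unfold potential
  rw [abs_of_nonneg (by positivity)]
  calc _ ≤ 1 * (2 * M / r ^ 3 + lam / r ^ 2) := by gcongr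
    _ ≤ _ := by rw [one_mul]; gcongr

theorem exists_abs_potentialDeriv_le {M lam : ℝ} (hM : 0 < M) (hl : 0 ≤ lam) :
    ∃ K, ∀ r, 2 * M < r → |potentialDeriv M lam r| ≤ K := by
  refine ⟨2 * (4 * lam / (2 * M) ^ 3 + 11 * M / (2 * M) ^ 4), fun r h2 => ?_⟩
  have h0 : 0 < r := by linarith
  have hd : 0 < 1 - 2 * M / r := by rw [sub_pos, div_lt_one h0]; linarith
  have hd1 : 1 - 2 * M / r ≤ 1 := by have : 0 < 2 * M / r := by positivity
                                     linarith
  have e : potentialDeriv M lam r = -2 * (1 - 2 * M / r) *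
      ((lam * r * (r - 3 * M) + M * (3 * r - 8 * M)) / r ^ 5) := by
    unfold potentialDeriv; ring
  have hn : |lam * r * (r - 3 * M) + M * (3 * r - 8 * M)| ≤ lam * r * (4 * r) + M * (11 * r) := by
    have h1 : 0 ≤ lam * r := by positivity
    rw [abs_le]; constructor <;> nlinarith [mul_nonneg h1 h0.le, mul_nonneg h1 hM.le,
      mul_pos hM h0, mul_pos hM hM, mul_nonneg h1 (sub_nonneg.2 h2.le)]
  rw [e, abs_mul, abs_mul, abs_div, abs_of_pos hd, abs_of_pos (pow_pos h0 5), abs_neg, abs_two]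
  calc _ ≤ 2 * 1 * ((lam * r * (4 * r) + M * (11 * r)) / r ^ 5) := by gcongr
    _ = 2 * (4 * lam / r ^ 3 + 11 * M / r ^ 4) := by field_simp
    _ ≤ _ := by gcongr

theorem exists_smooth_sign {A B : ℝ} (hAB : A ≤ B) :
    ∃ (σ dσ : ℝ → ℝ) (K : ℝ), 0 < K ∧ (∀ x, HasDerivAt σ (dσ x) x) ∧ Continuous dσ ∧
      (∀ x, |dσ x| ≤ K) ∧ (∀ x, |σ x| ≤ 1) ∧ (∀ x < A - 2, σ x = -1 ∧ dσ x = 0) ∧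
      (∀ x ≤ B + 1, σ x ≤ 0) ∧ (∀ x ∈ Set.Ioo (A - 1) (B + 1), σ x = 0 ∧ dσ x = 0) ∧
      (∀ x ≥ A - 1, 0 ≤ σ x) ∧ (∀ x > B + 2, σ x = 1 ∧ dσ x = 0) := by
  set σ : ℝ → ℝ := fun x =>
    Real.smoothTransition (x - (B + 1)) - Real.smoothTransition (A - 1 - x) with hσ
  have hsm : ContDiff ℝ 1 σ := by
    have := Real.smoothTransition.contDiff (n := 1)
    exact (this.comp (contDiff_id.sub contDiff_const)).sub
      (this.comp (contDiff_const.sub contDiff_id))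
  have hd : Continuous (deriv σ) := hsm.continuous_deriv le_rfl
  have hconst : ∀ (s : Set ℝ) (c : ℝ), IsOpen s → (∀ x ∈ s, σ x = c) → ∀ x ∈ s,
      σ x = c ∧ deriv σ x = 0 := by
    intro s c hs h x hx
    refine ⟨h x hx, ?_⟩
    have : σ =ᶠ[nhds x] fun _ => c := by
      filter_upwards [hs.mem_nhds hx] with y hy using h y hy
    rw [this.deriv_eq, deriv_const]
  have hl := hconst (Set.Iio (A - 2)) (-1) isOpen_Iio (by
    intro x hx
    rw [Set.mem_Iio] at hx
    simp only [hσ]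
    rw [Real.smoothTransition.zero_of_nonpos (by linarith),
      Real.smoothTransition.one_of_one_le (by linarith)]
    norm_num)
  have hr := hconst (Set.Ioi (B + 2)) 1 isOpen_Ioi (by
    intro x hx
    rw [Set.mem_Ioi] at hx
    simp only [hσ]
    rw [Real.smoothTransition.zero_of_nonpos (x := A - 1 - x) (by linarith),
      Real.smoothTransition.one_of_one_le (by linarith)]
    norm_num)
  have hm := hconst (Set.Ioo (A - 1) (B + 1)) 0 isOpen_Ioo (by
    intro x hx
    simp only [hσ]
    rw [Real.smoothTransition.zero_of_nonpos (x := A - 1 - x) (by linarith [hx.1]),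
      Real.smoothTransition.zero_of_nonpos (by linarith [hx.2])]
    norm_num)
  obtain ⟨K, hK⟩ := (isCompact_Icc (a := A - 2) (b := B + 2)).exists_bound_of_continuousOn
    hd.continuousOn
  refine ⟨σ, deriv σ, |K| + 1, by positivity,
    fun x => (hsm.differentiable one_ne_zero x).hasDerivAt, hd, fun x => ?_, fun x => ?_,
    hl, fun x hx => ?_, hm, fun x hx => ?_, hr⟩
  · rcases lt_or_ge x (A - 2) with h | h
    · rw [(hl x h).2, abs_zero]; positivity
    rcases lt_or_ge (B + 2) x with h' | h'
    · rw [(hr x h').2, abs_zero]; positivity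
    · have := hK x ⟨h, h'⟩
      rw [Real.norm_eq_abs] at this
      linarith [le_abs_self K]
  · have h1 := Real.smoothTransition.nonneg (x - (B + 1))
    have h2 := Real.smoothTransition.nonneg (A - 1 - x)
    have h3 := Real.smoothTransition.le_one (x - (B + 1))
    have h4 := Real.smoothTransition.le_one (A - 1 - x)
    rw [abs_le]
    constructor <;> simp only [hσ] <;> linarith
  · have h2 := Real.smoothTransition.nonneg (A - 1 - x)
    simp only [hσ]
    rw [Real.smoothTransition.zero_of_nonpos (by linarith)]
    linarith
  · have h2 := Real.smoothTransition.nonneg (x - (B + 1))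
    simp only [hσ]
    rw [Real.smoothTransition.zero_of_nonpos (x := A - 1 - x) (by linarith)]
    linarith

theorem half_le_arctan {y : ℝ} (h0 : 0 ≤ y) (h1 : y ≤ 1) : y / 2 ≤ Real.arctan y := by
  have hd : ∀ z, HasDerivAt (fun z => Real.arctan z - z / 2) (1 / (1 + z ^ 2) - 1 / 2) z :=
    fun z => (Real.hasDerivAt_arctan z).sub ((hasDerivAt_id z).div_const 2)
  have hmono : MonotoneOn (fun z => Real.arctan z - z / 2) (Set.Icc 0 1) := by
    apply monotoneOn_of_deriv_nonneg (convex_Icc 0 1)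
    · exact fun z _ => (hd z).continuousAt.continuousWithinAt
    · exact fun z _ => (hd z).differentiableAt.differentiableWithinAt
    · intro z hz
      rw [interior_Icc] at hz
      rw [(hd z).deriv, sub_nonneg]
      apply one_div_le_one_div_of_le (by positivity)
      nlinarith [hz.1, hz.2]
  have := hmono (Set.left_mem_Icc.2 zero_le_one) ⟨h0, h1⟩ h0
  simp only [Real.arctan_zero] at this
  linarith

theorem neg_half_ge_arctan {y : ℝ} (h0 : y ≤ 0) (h1 : -1 ≤ y) : Real.arctan y ≤ y / 2 := by
  have := half_le_arctan (y := -y) (by linarith) (by linarith)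
  rw [Real.arctan_neg] at this
  linarith

/-- The multiplier form is coercive once its discriminant is controlled. -/
theorem multiplier_form_lower_bound {σ G X Y : ℝ}
    (hG : 1 / 200 + (49 / 100) * σ ^ 2 / (199 / 200) ≤ G) :
    1 / 200 * (X ^ 2 + Y ^ 2) ≤ X ^ 2 - 2 * (7 / 10) * σ * X * Y + G * Y ^ 2 := by
  have h1 : 0 ≤ (G - (1 / 200 + (49 / 100) * σ ^ 2 / (199 / 200))) * Y ^ 2 :=
    mul_nonneg (sub_nonneg.2 hG) (sq_nonneg Y)
  nlinarith [sq_nonneg (199 / 200 * X - 7 / 10 * σ * Y)]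

/-- A Morawetz multiplier `f`, with corrector `p`, adapted to the potential derivative `w`. -/
structure Multiplier (w : ℝ → ℝ) (c C : ℝ) where
  (f f₁ f₂ f₃ p p₁ : ℝ → ℝ)
  hf : ∀ x, HasDerivAt f (f₁ x) x
  hf₁ : ∀ x, HasDerivAt f₁ (f₂ x) x
  hf₂ : ∀ x, HasDerivAt f₂ (f₃ x) x
  hp : ∀ x, HasDerivAt p (p₁ x) x
  hf₃ : Continuous f₃
  hp₁ : Continuous p₁
  f_le : ∀ x, |f x| ≤ C
  f₁_le : ∀ x, |f₁ x| ≤ C / (1 + x ^ 2)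
  f₂_le : ∀ x, |f₂ x| ≤ C
  f₃_le : ∀ x, |f₃ x| ≤ C
  p_le : ∀ x, |p x| ≤ C
  p₁_le : ∀ x, |p₁ x| ≤ C
  lower : ∀ x u v, c * (u ^ 2 / (1 + x ^ 2) ^ 2 + v ^ 2 / (1 + x ^ 2)) ≤
    f₁ x * v ^ 2 + 2 * p x * u * v + (p₁ x - f x * w x / 2 - f₃ x / 4) * u ^ 2

/-- The scalar inequality behind the multiplier estimate. -/
theorem discriminant_lower_bound {A B K c₀ a x x₀ w σ dσ s : ℝ} (hK : 0 < K) (hc₀ : 0 < c₀)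
    (ha1 : 4 * (B - A + 2) ≤ a) (ha2 : (6 * K + 4) / c₀ ≤ a) (ha : 1 ≤ a)
    (hx₀ : x₀ ∈ Set.Icc A B)
    (hw : (x - x₀) * w ≤ 0) (hwr : x ∈ Set.Icc (B + 1) (B + 2) → c₀ ≤ -w)
    (hwl : x ∈ Set.Icc (A - 2) (A - 1) → c₀ ≤ w)
    (hdσ : |dσ| ≤ K) (hσ : |σ| ≤ 1) (h1 : x < A - 2 → σ = -1 ∧ dσ = 0)
    (h2 : x ≤ B + 1 → σ ≤ 0) (h3 : x ∈ Set.Ioo (A - 1) (B + 1) → σ = 0 ∧ dσ = 0)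
    (h4 : x ≥ A - 1 → 0 ≤ σ) (h5 : x > B + 2 → σ = 1 ∧ dσ = 0)
    (hs : s = √(1 + ((x - x₀) / a) ^ 2)) :
    1 / 200 + (49 / 100) * σ ^ 2 / (199 / 200) ≤
      -(a * (7 / 10) * dσ * s) + 3 * (7 / 10) * σ * ((x - x₀) / a / s)
        + (1 / 2 - 2 * ((x - x₀) / a / s) ^ 2)
        - a ^ 4 * (Real.arctan ((x - x₀) / a) / a) * w / 2 * s ^ 4 := by
  have ha0 : 0 < a := by linarith
  set y := (x - x₀) / a with hy
  have hxy : x - x₀ = a * y := by rw [hy]; field_simp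
  have hs0 : 0 < s := by rw [hs]; positivity
  have hs2 : s ^ 2 = 1 + y ^ 2 := by rw [hs, Real.sq_sqrt (by positivity)]
  have hs1 : 1 ≤ s := by nlinarith [sq_nonneg y]
  set z := y / s with hz
  have hyz : y = z * s := by rw [hz]; field_simp
  have hz1 : |z| ≤ 1 := by
    rw [abs_le]; constructor
    · rw [hz, le_div_iff₀ hs0]; nlinarith
    · rw [hz, div_le_iff₀ hs0]; nlinarith
  have hzy : z ^ 2 ≤ y ^ 2 := by rw [hyz, mul_pow, hs2]; nlinarith [sq_nonneg z, sq_nonneg y]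
  obtain ⟨hzl, hzr⟩ := abs_le.1 hz1
  obtain ⟨hσl, hσr⟩ := abs_le.1 hσ
  obtain ⟨hdl, hdr⟩ := abs_le.1 hdσ
  have hfw : 0 ≤ -(Real.arctan y * w) := by
    rcases le_total 0 y with h | h
    · have : 0 ≤ Real.arctan y := Real.arctan_nonneg.2 h
      rcases h.eq_or_lt with h' | h'
      · simp [← h']
      · have : w ≤ 0 := by
          by_contra! hwn
          have := mul_pos (mul_pos ha0 h') hwn
          rw [← hxy] at this; linarith
        nlinarith
    · have : Real.arctan y ≤ 0 := Real.arctan_zero ▸ Real.arctan_strictMono.monotone h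
      rcases h.eq_or_lt with h' | h'
      · simp [h']
      · have : 0 ≤ w := by
          by_contra! hwn
          have := mul_pos_of_neg_of_neg (mul_neg_of_pos_of_neg ha0 h') hwn
          rw [← hxy] at this; linarith
        nlinarith
  have hfw' : a ^ 4 * (Real.arctan y / a) * w / 2 * s ^ 4 =
      -(a ^ 3 * s ^ 4 / 2 * -(Real.arctan y * w)) := by field_simp
  rw [hfw']
  have hq0 : 0 ≤ a ^ 3 * s ^ 4 / 2 * -(Real.arctan y * w) := mul_nonneg (by positivity) hfw
  have hσ2 : σ ^ 2 ≤ 1 := by nlinarith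
  have hwin : |x - x₀| ≤ B - A + 2 → y ^ 2 ≤ 1 / 16 := by
    intro h
    have : |y| ≤ 1 / 4 := by
      rw [hy, abs_div, abs_of_pos ha0, div_le_iff₀ ha0]; linarith
    rw [← sq_abs]
    nlinarith [abs_nonneg y]
  -- the transition windows
  have hmid : y ^ 2 ≤ 1 / 16 → 0 ≤ σ * z → c₀ / (2 * a) ≤ -(Real.arctan y * w) →
      1 / 200 + (49 / 100) * σ ^ 2 / (199 / 200) ≤
      -(a * (7 / 10) * dσ * s) + 3 * (7 / 10) * σ * z + (1 / 2 - 2 * z ^ 2)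
        - -(a ^ 3 * s ^ 4 / 2 * -(Real.arctan y * w)) := by
    intro hy2 hσz hlow
    have hs3 : s ≤ 2 := by
      by_contra! h
      nlinarith only [h, hs2, hy2]
    have e1 : a * (7 / 10) * dσ * s ≤ a * (7 / 10) * K * 2 := by
      have : dσ * s ≤ K * 2 := mul_le_mul hdr hs3 hs0.le hK.le
      have := mul_le_mul_of_nonneg_left this (show 0 ≤ a * (7 / 10) by positivity)
      linarith only [this]
    have e2 : a ^ 3 * 1 / 2 * (c₀ / (2 * a)) ≤ a ^ 3 * s ^ 4 / 2 * -(Real.arctan y * w) := by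
      have : 1 ≤ s ^ 4 := one_le_pow₀ hs1
      gcongr
    have e3 : a ^ 3 * 1 / 2 * (c₀ / (2 * a)) = a * (a * c₀) / 4 := by field_simp; ring
    have e4 : 6 * K + 4 ≤ a * c₀ := by rwa [div_le_iff₀ hc₀] at ha2
    have e5 : a * (6 * K + 4) ≤ a * (a * c₀) := by gcongr
    linarith only [mul_pos ha0 hK, e1, e2, e3, e5, hσz, hzy, hy2, hσ2, ha]
  obtain ⟨hxA, hxB⟩ := hx₀
  rcases lt_or_ge x (A - 2) with hx | hx
  · obtain ⟨rfl, rfl⟩ := h1 hx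
    have : z ≤ 0 := by
      apply div_nonpos_of_nonpos_of_nonneg _ hs0.le
      apply div_nonpos_of_nonpos_of_nonneg _ ha0.le
      linarith
    nlinarith only [this, hzl, hzr, hq0]
  rcases le_or_gt x (A - 1) with hx' | hx'
  · have hy0 : y ≤ -1 / a := by rw [hy]; gcongr; linarith
    have hyn : y ≤ 0 := hy0.trans (div_nonpos_of_nonpos_of_nonneg (by norm_num) ha0.le)
    have hy2 := hwin (by rw [abs_le]; constructor <;> linarith)
    have hat := neg_half_ge_arctan hyn (by nlinarith only [hy2])
    have hw' := hwl ⟨hx, hx'⟩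
    have hzn : z ≤ 0 := div_nonpos_of_nonpos_of_nonneg hyn hs0.le
    refine hmid hy2 (mul_nonneg_of_nonpos_of_nonpos (h2 (by linarith)) hzn) ?_
    have : 1 / (2 * a) ≤ -Real.arctan y := by
      have : 1 / (2 * a) = - (-1 / a) / 2 := by field_simp
      linarith
    calc c₀ / (2 * a) = 1 / (2 * a) * c₀ := by ring
      _ ≤ -Real.arctan y * w := by
        apply mul_le_mul this hw' hc₀.le (le_trans (by positivity) this)
      _ = _ := by ring
  rcases lt_or_ge x (B + 1) with hx2 | hx2
  · obtain ⟨rfl, rfl⟩ := h3 ⟨hx', hx2⟩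
    have hy2 := hwin (by rw [abs_le]; constructor <;> linarith)
    linarith only [hy2, hzy, hq0]
  rcases le_or_gt x (B + 2) with hx3 | hx3
  · have hy0 : 1 / a ≤ y := by rw [hy]; gcongr; linarith
    have hyn : 0 ≤ y := le_trans (by positivity) hy0
    have hy2 := hwin (by rw [abs_le]; constructor <;> linarith)
    have hat := half_le_arctan hyn (by nlinarith only [hy2])
    have hw' := hwr ⟨hx2, hx3⟩
    have hzn : 0 ≤ z := div_nonneg hyn hs0.le
    refine hmid hy2 (mul_nonneg (h4 (by linarith)) hzn) ?_
    have : 1 / (2 * a) ≤ Real.arctan y := by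
      have : 1 / (2 * a) = (1 / a) / 2 := by field_simp
      linarith
    calc c₀ / (2 * a) = 1 / (2 * a) * c₀ := by ring
      _ ≤ Real.arctan y * -w := by
        apply mul_le_mul this hw' hc₀.le (le_trans (by positivity) this)
      _ = _ := by ring
  · obtain ⟨rfl, rfl⟩ := h5 hx3
    have : 0 ≤ z := by
      apply div_nonneg _ hs0.le
      apply div_nonneg _ ha0.le
      linarith
    nlinarith only [this, hzl, hzr, hq0]

theorem exists_multiplier {A B c₀ : ℝ} (hAB : A ≤ B) (hc₀ : 0 < c₀) :
    ∃ c C : ℝ, 0 < c ∧ 0 < C ∧ ∀ x₀ ∈ Set.Icc A B, ∀ w : ℝ → ℝ,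
      (∀ x, (x - x₀) * w x ≤ 0) → (∀ x ∈ Set.Icc (B + 1) (B + 2), c₀ ≤ -w x) →
      (∀ x ∈ Set.Icc (A - 2) (A - 1), c₀ ≤ w x) → Nonempty (Multiplier w c C) := by
  obtain ⟨σ, dσ, K, hK, hσd, hdσc, hdσ, hσ, h1, h2, h3, h4, h5⟩ := exists_smooth_sign hAB
  set a : ℝ := max 1 (max (4 * (B - A + 2)) ((6 * K + 4) / c₀)) with ha
  have ha1 : 1 ≤ a := le_max_left _ _
  have ha2 : 4 * (B - A + 2) ≤ a := (le_max_left _ _).trans (le_max_right _ _)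
  have ha3 : (6 * K + 4) / c₀ ≤ a := (le_max_right _ _).trans (le_max_right _ _)
  clear_value a
  have ha0 : 0 < a := by linarith
  set L := |A| + |B|
  have hL : 0 ≤ L := by positivity
  set D := 2 * a ^ 2 + 2 * L ^ 2 + 1 with hD
  have hD1 : 1 ≤ D := by rw [hD]; nlinarith
  refine ⟨1 / 200 / (D ^ 2 * a ^ 4), D + K + 10, by positivity, by positivity,
    fun x₀ hx₀ w hw hwr hwl => ?_⟩
  have hx₀L : x₀ ^ 2 ≤ L ^ 2 := by
    apply sq_le_sq'
    · linarith [neg_abs_le A, hx₀.1, abs_nonneg B]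
    · linarith [le_abs_self B, hx₀.2, abs_nonneg A]
  set y : ℝ → ℝ := fun x => (x - x₀) / a with hy
  have hyd : ∀ x, HasDerivAt y (1 / a) x := fun x =>
    ((hasDerivAt_id x).sub_const x₀).div_const a
  have hyc : Continuous y := by fun_prop
  have hxy : ∀ x, x = a * y x + x₀ := fun x => by simp only [hy]; field_simp; ring
  have hDx : ∀ x, 1 + x ^ 2 ≤ D * (1 + y x ^ 2) := fun x => by
    have : x ^ 2 ≤ 2 * a ^ 2 * y x ^ 2 + 2 * x₀ ^ 2 := by
      conv_lhs => rw [hxy x]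
      nlinarith [sq_nonneg (a * y x - x₀)]
    rw [hD]
    nlinarith [mul_nonneg (sq_nonneg L) (sq_nonneg (y x)), sq_nonneg (y x), sq_nonneg a]
  have hDy : ∀ x, 1 + y x ^ 2 ≤ D * (1 + x ^ 2) := fun x => by
    have : y x ^ 2 ≤ (x - x₀) ^ 2 := by
      simp only [hy, div_pow]
      exact div_le_self (sq_nonneg _) (one_le_pow₀ ha1)
    rw [hD]
    nlinarith [mul_nonneg (sq_nonneg L) (sq_nonneg x), sq_nonneg x, sq_nonneg (x + x₀),
      mul_nonneg (sub_nonneg.2 (one_le_pow₀ ha1 : 1 ≤ a ^ 2)) (sq_nonneg x),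
      (one_le_pow₀ ha1 : 1 ≤ a ^ 2)]
  clear_value D L
  set s : ℝ → ℝ := fun x => √(1 + y x ^ 2) with hs
  have hs2 : ∀ x, s x ^ 2 = 1 + y x ^ 2 := fun x => Real.sq_sqrt (by positivity)
  have hs0 : ∀ x, 0 < s x := fun x => Real.sqrt_pos.2 (by positivity)
  have hs1 : ∀ x, 1 ≤ s x := fun x => by nlinarith [hs0 x, hs2 x, sq_nonneg (y x)]
  have hsc : Continuous s := by fun_prop
  have hyd2 : ∀ x, HasDerivAt (fun x => 1 + y x ^ 2) (2 * y x / a) x := fun x =>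
    (((hyd x).fun_pow 2).const_add 1).congr_deriv (by norm_num; ring)
  have hsd : ∀ x, HasDerivAt s (y x / (a * s x)) x := fun x =>
    ((hyd2 x).sqrt (by positivity)).congr_deriv (by simp only [hs]; field_simp)
  have hσc : Continuous σ := continuous_iff_continuousAt.2 fun x => (hσd x).continuousAt
  have hys : ∀ x, |y x| ≤ s x := fun x => Real.abs_le_sqrt (by linarith [sq_nonneg (y x)])
  refine ⟨⟨fun x => Real.arctan (y x) / a, fun x => 1 / (a ^ 2 * (1 + y x ^ 2)),
    fun x => -2 * y x / (a ^ 3 * (1 + y x ^ 2) ^ 2),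
    fun x => (6 * y x ^ 2 - 2) / (a ^ 4 * (1 + y x ^ 2) ^ 3),
    fun x => -(7 / 10 * σ x) / (a ^ 3 * s x ^ 3),
    fun x => -(7 / 10 * dσ x) / (a ^ 3 * s x ^ 3) + 3 * (7 / 10) * σ x * y x / (a ^ 4 * s x ^ 5),
    fun x => ?_, fun x => ?_, fun x => ?_, fun x => ?_, ?_, ?_, fun x => ?_, fun x => ?_,
    fun x => ?_, fun x => ?_, fun x => ?_, fun x => ?_, fun x u v => ?_⟩⟩
  · exact ((hyd x).arctan.div_const a).congr_deriv (by field_simp)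
  · refine ((hasDerivAt_const x (1 : ℝ)).fun_div ((hyd2 x).const_mul (a ^ 2))
      (by positivity)).congr_deriv ?_
    field_simp
    ring
  · refine (((hyd x).const_mul (-2)).fun_div (((hyd2 x).fun_pow 2).const_mul (a ^ 3))
      (by positivity)).congr_deriv ?_
    norm_num
    field_simp
    ring
  · have := (hs0 x)
    refine ((((hσd x).const_mul (7 / 10)).fun_neg).fun_div (((hsd x).fun_pow 3).const_mul (a ^ 3))
      (by positivity)).congr_deriv ?_
    norm_num
    field_simp
    ring
  · exact (by fun_prop : Continuous fun x => 6 * y x ^ 2 - 2).div (by fun_prop)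
      fun x => by positivity
  · exact ((by fun_prop : Continuous fun x => -(7 / 10 * dσ x)).div (by fun_prop)
      fun x => by have := hs0 x; positivity).add
      ((by fun_prop : Continuous fun x => 3 * (7 / 10) * σ x * y x).div (by fun_prop)
      fun x => by have := hs0 x; positivity)
  · rw [abs_div, abs_of_pos ha0]
    have h : |Real.arctan (y x)| ≤ 2 := by
      rw [abs_le]
      constructor <;> linarith [Real.neg_pi_div_two_lt_arctan (y x),
        Real.arctan_lt_pi_div_two (y x), Real.pi_lt_four]
    have := div_le_self (abs_nonneg (Real.arctan (y x))) ha1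
    linarith
  · rw [abs_of_nonneg (by positivity), div_le_div_iff₀ (by positivity) (by positivity), one_mul]
    have h : 1 ≤ a ^ 2 := one_le_pow₀ ha1
    calc 1 + x ^ 2 ≤ D * (1 * (1 + y x ^ 2)) := by rw [one_mul]; exact hDx x
      _ ≤ (D + K + 10) * (a ^ 2 * (1 + y x ^ 2)) := by gcongr; linarith
  · rw [abs_div, abs_of_pos (a := a ^ 3 * (1 + y x ^ 2) ^ 2) (by positivity)]
    have h : 1 ≤ a ^ 3 := one_le_pow₀ ha1
    have h' : |(-2) * y x| ≤ 2 * (1 + y x ^ 2) ^ 2 := by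
      rw [abs_le]; constructor <;>
        nlinarith [sq_nonneg (y x ^ 2), sq_nonneg (y x), sq_nonneg (y x - 1), sq_nonneg (y x + 1)]
    rw [div_le_iff₀ (by positivity)]
    calc _ ≤ 2 * (1 * (1 + y x ^ 2) ^ 2) := by rw [one_mul]; exact h'
      _ ≤ (D + K + 10) * (a ^ 3 * (1 + y x ^ 2) ^ 2) := by gcongr; linarith
  · rw [abs_div, abs_of_pos (a := a ^ 4 * (1 + y x ^ 2) ^ 3) (by positivity)]
    have h : 1 ≤ a ^ 4 := one_le_pow₀ ha1
    have h' : |6 * y x ^ 2 - 2| ≤ 6 * (1 + y x ^ 2) ^ 3 := by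
      have : 0 ≤ (y x ^ 2) ^ 3 := by positivity
      rw [abs_le]; constructor <;> nlinarith [sq_nonneg (y x ^ 2), sq_nonneg (y x)]
    rw [div_le_iff₀ (by positivity)]
    calc _ ≤ 6 * (1 * (1 + y x ^ 2) ^ 3) := by rw [one_mul]; exact h'
      _ ≤ (D + K + 10) * (a ^ 4 * (1 + y x ^ 2) ^ 3) := by gcongr; linarith
  · have hsp := hs0 x
    rw [abs_div, abs_neg, abs_mul, abs_of_pos (a := a ^ 3 * s x ^ 3) (by positivity)]
    have h : 1 ≤ a ^ 3 * s x ^ 3 := one_le_mul_of_one_le_of_one_le (one_le_pow₀ ha1)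
      (one_le_pow₀ (hs1 x))
    refine (div_le_self (by positivity) h).trans ?_
    rw [abs_of_pos (by norm_num : (0 : ℝ) < 7 / 10)]
    linarith [hσ x]
  · have hsp := hs0 x
    refine (abs_add_le _ _).trans ?_
    have e1 : |-(7 / 10 * dσ x) / (a ^ 3 * s x ^ 3)| ≤ K := by
      rw [abs_div, abs_neg, abs_mul, abs_of_pos (a := a ^ 3 * s x ^ 3) (by positivity)]
      have h : 1 ≤ a ^ 3 * s x ^ 3 := one_le_mul_of_one_le_of_one_le (one_le_pow₀ ha1)
        (one_le_pow₀ (hs1 x))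
      refine (div_le_self (by positivity) h).trans ?_
      rw [abs_of_pos (by norm_num : (0 : ℝ) < 7 / 10)]
      linarith [hdσ x]
    have e2 : |3 * (7 / 10) * σ x * y x / (a ^ 4 * s x ^ 5)| ≤ 3 := by
      rw [abs_div, abs_of_pos (a := a ^ 4 * s x ^ 5) (by positivity), div_le_iff₀ (by positivity),
        abs_mul, abs_mul, abs_of_pos (by norm_num : (0 : ℝ) < 3 * (7 / 10))]
      have h : s x ≤ a ^ 4 * s x ^ 5 := by
        have : 1 ≤ a ^ 4 * s x ^ 4 := one_le_mul_of_one_le_of_one_le (one_le_pow₀ ha1)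
          (one_le_pow₀ (hs1 x))
        calc s x = 1 * s x := (one_mul _).symm
          _ ≤ a ^ 4 * s x ^ 4 * s x := by gcongr
          _ = _ := by ring
      have := mul_le_mul (hσ x) (hys x) (abs_nonneg _) zero_le_one
      nlinarith [hs0 x]
    linarith
  · have hsp := hs0 x
    have hG := discriminant_lower_bound (s := s x) hK hc₀ ha2 ha3 ha1 hx₀ (hw x) (hwr x) (hwl x)
      (hdσ x) (hσ x) (h1 x) (h2 x) (h3 x) (h4 x) (h5 x) rfl
    have key := multiplier_form_lower_bound (X := a * v / s x) (Y := u / s x ^ 2) hG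
    have hsD : s x ^ 2 ≤ D * (1 + x ^ 2) := by rw [hs2]; exact hDy x
    have e1 : v ^ 2 / (1 + x ^ 2) ≤ D ^ 2 * (a * v / s x) ^ 2 := by
      have h : 1 ≤ a ^ 2 := one_le_pow₀ ha1
      rw [div_pow, mul_div_assoc', div_le_div_iff₀ (by positivity) (by positivity)]
      calc v ^ 2 * s x ^ 2 ≤ v ^ 2 * (D * (1 + x ^ 2)) := by gcongr
        _ = D * (1 * v) ^ 2 * (1 + x ^ 2) := by ring
        _ ≤ D ^ 2 * (a * v) ^ 2 * (1 + x ^ 2) := by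
          rw [mul_pow, mul_pow, one_pow]
          gcongr
          exact le_self_pow₀ hD1 two_ne_zero
    have e2 : u ^ 2 / (1 + x ^ 2) ^ 2 ≤ D ^ 2 * (u / s x ^ 2) ^ 2 := by
      rw [div_pow, mul_div_assoc', div_le_div_iff₀ (by positivity) (by positivity)]
      calc u ^ 2 * (s x ^ 2) ^ 2 ≤ u ^ 2 * (D * (1 + x ^ 2)) ^ 2 := by gcongr
        _ = _ := by ring
    have e3 : u ^ 2 / (1 + x ^ 2) ^ 2 + v ^ 2 / (1 + x ^ 2) ≤
        D ^ 2 * ((a * v / s x) ^ 2 + (u / s x ^ 2) ^ 2) := by linarith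
    rw [div_mul_eq_mul_div, div_le_iff₀ (by positivity)]
    have e4 := mul_le_mul_of_nonneg_left e3 (by norm_num : (0 : ℝ) ≤ 1 / 200)
    refine e4.trans ?_
    have e5 := mul_le_mul_of_nonneg_left key (by positivity : 0 ≤ D ^ 2)
    refine le_trans (le_of_eq (by ring)) (e5.trans (le_of_eq ?_))
    have hy2 : y x ^ 2 = s x ^ 2 - 1 := by rw [hs2]; ring
    rw [show (x - x₀) / a = y x from rfl]
    simp only [← hs2]
    field_simp
    rw [hy2]
    ring

section PartialDerivatives

variable {g : ℝ → ℝ → ℝ}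

theorem deriv_snd_eq_fderiv (hg : ContDiff ℝ (⊤ : ℕ∞) (Function.uncurry g)) (t x : ℝ) :
    HasDerivAt (g t) (fderiv ℝ (Function.uncurry g) (t, x) (0, 1)) x :=
  ((hg.differentiable (by simp) (t, x)).hasFDerivAt).comp_hasDerivAt x
    ((hasDerivAt_const x t).prodMk (hasDerivAt_id x))

theorem deriv_fst_eq_fderiv (hg : ContDiff ℝ (⊤ : ℕ∞) (Function.uncurry g)) (t x : ℝ) :
    HasDerivAt (fun s => g s x) (fderiv ℝ (Function.uncurry g) (t, x) (1, 0)) t :=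
  ((hg.differentiable (by simp) (t, x)).hasFDerivAt).comp_hasDerivAt (f := fun s => (s, x)) t
    ((hasDerivAt_id t).prodMk (hasDerivAt_const t x))

theorem contDiff_fderiv_apply (hg : ContDiff ℝ (⊤ : ℕ∞) (Function.uncurry g)) (v : ℝ × ℝ) :
    ContDiff ℝ (⊤ : ℕ∞) (fun z => fderiv ℝ (Function.uncurry g) z v) :=
  (hg.fderiv_right (m := (⊤ : ℕ∞)) (by simp)).clm_apply contDiff_const

theorem contDiff_deriv_snd (hg : ContDiff ℝ (⊤ : ℕ∞) (Function.uncurry g)) :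
    ContDiff ℝ (⊤ : ℕ∞) (Function.uncurry fun t x => deriv (g t) x) := by
  convert contDiff_fderiv_apply hg (0, 1) using 1
  ext ⟨t, x⟩
  exact (deriv_snd_eq_fderiv hg t x).deriv

theorem contDiff_deriv_fst (hg : ContDiff ℝ (⊤ : ℕ∞) (Function.uncurry g)) :
    ContDiff ℝ (⊤ : ℕ∞) (Function.uncurry fun t x => deriv (fun s => g s x) t) := by
  convert contDiff_fderiv_apply hg (1, 0) using 1
  ext ⟨t, x⟩
  exact (deriv_fst_eq_fderiv hg t x).deriv

theorem hasDerivAt_snd (hg : ContDiff ℝ (⊤ : ℕ∞) (Function.uncurry g)) (t x : ℝ) :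
    HasDerivAt (g t) (deriv (g t) x) x :=
  (deriv_snd_eq_fderiv hg t x).differentiableAt.hasDerivAt

theorem hasDerivAt_fst (hg : ContDiff ℝ (⊤ : ℕ∞) (Function.uncurry g)) (t x : ℝ) :
    HasDerivAt (fun s => g s x) (deriv (fun s => g s x) t) t :=
  (deriv_fst_eq_fderiv hg t x).differentiableAt.hasDerivAt

theorem deriv_comm (hg : ContDiff ℝ (⊤ : ℕ∞) (Function.uncurry g)) (t x : ℝ) :
    deriv (fun y => deriv (fun s => g s y) t) x = deriv (fun s => deriv (g s) x) t := by
  have hd : DifferentiableAt ℝ (fderiv ℝ (Function.uncurry g)) (t, x) :=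
    (hg.fderiv_right (m := (⊤ : ℕ∞)) (by simp)).differentiable (by simp) _
  have hsymm : IsSymmSndFDerivAt ℝ (Function.uncurry g) (t, x) :=
    hg.contDiffAt.isSymmSndFDerivAt (by
      rw [minSmoothness_of_isRCLikeNormedField]
      exact WithTop.coe_le_coe.2 (le_top : (2 : ℕ∞) ≤ ⊤))
  have h1 : (fun y => deriv (fun s => g s y) t) =
      fun y => fderiv ℝ (Function.uncurry g) (t, y) (1, 0) :=
    funext fun y => (deriv_fst_eq_fderiv hg t y).deriv
  have h2 : (fun s => deriv (g s) x) = fun s => fderiv ℝ (Function.uncurry g) (s, x) (0, 1) :=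
    funext fun s => (deriv_snd_eq_fderiv hg s x).deriv
  have e1 : HasDerivAt (fun y => fderiv ℝ (Function.uncurry g) (t, y))
      (fderiv ℝ (fderiv ℝ (Function.uncurry g)) (t, x) (0, 1)) x :=
    hd.hasFDerivAt.comp_hasDerivAt x ((hasDerivAt_const x t).prodMk (hasDerivAt_id x))
  have e2 : HasDerivAt (fun s => fderiv ℝ (Function.uncurry g) (s, x))
      (fderiv ℝ (fderiv ℝ (Function.uncurry g)) (t, x) (1, 0)) t :=
    hd.hasFDerivAt.comp_hasDerivAt t ((hasDerivAt_id t).prodMk (hasDerivAt_const t x))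
  rw [h1, h2, (e1.clm_apply (hasDerivAt_const x _)).deriv,
    (e2.clm_apply (hasDerivAt_const t _)).deriv]
  simpa using hsymm (0, 1) (1, 0)

end PartialDerivatives

/-- Continuous functions decaying at least quadratically in space, uniformly for `t ∈ [0, T]`. -/
structure Decaying (T : ℝ) (g : ℝ → ℝ → ℝ) : Prop where
  cont : Continuous (Function.uncurry g)
  bound : ∃ B : ℝ, ∀ t ∈ Set.Icc (0 : ℝ) T, ∀ x, |g t x| * (1 + x ^ 2) ≤ B

namespace Decaying

variable {T : ℝ} {g h : ℝ → ℝ → ℝ}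

theorem add (hg : Decaying T g) (hh : Decaying T h) : Decaying T fun t x => g t x + h t x := by
  obtain ⟨B, hB⟩ := hg.bound
  obtain ⟨B', hB'⟩ := hh.bound
  refine ⟨hg.cont.add hh.cont, B + B', fun t ht x => ?_⟩
  have := mul_le_mul_of_nonneg_right (abs_add_le (g t x) (h t x)) (by positivity : 0 ≤ 1 + x ^ 2)
  linarith [hB t ht x, hB' t ht x]

theorem coeff_mul {k : ℝ → ℝ} {C : ℝ} (hk : Continuous k) (hkC : ∀ x, |k x| ≤ C)
    (hg : Decaying T g) : Decaying T fun t x => k x * g t x := by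
  obtain ⟨B, hB⟩ := hg.bound
  refine ⟨(hk.comp continuous_snd).mul hg.cont, C * B, fun t ht x => ?_⟩
  rw [abs_mul, mul_assoc]
  exact mul_le_mul (hkC x) (hB t ht x) (by positivity) ((abs_nonneg _).trans (hkC x))

theorem const_mul (c : ℝ) (hg : Decaying T g) : Decaying T fun t x => c * g t x :=
  hg.coeff_mul (k := fun _ => c) continuous_const fun _ => le_rfl

theorem sub (hg : Decaying T g) (hh : Decaying T h) : Decaying T fun t x => g t x - h t x := by
  simpa [sub_eq_add_neg] using hg.add (hh.const_mul (-1))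

theorem mul (hg : Decaying T g) (hh : Decaying T h) : Decaying T fun t x => g t x * h t x := by
  obtain ⟨B, hB⟩ := hg.bound
  obtain ⟨B', hB'⟩ := hh.bound
  refine ⟨hg.cont.mul hh.cont, B * B', fun t ht x => ?_⟩
  have h1 : |h t x| ≤ B' := by
    refine le_trans ?_ (hB' t ht x)
    exact le_mul_of_one_le_right (abs_nonneg _) (by nlinarith)
  rw [abs_mul, mul_right_comm]
  exact mul_le_mul (hB t ht x) h1 (abs_nonneg _) (le_trans (by positivity) (hB t ht x))

theorem sq (hg : Decaying T g) : Decaying T fun t x => g t x ^ 2 := by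
  simpa only [pow_two] using hg.mul hg

theorem integrable (hg : Decaying T g) {t : ℝ} (ht : t ∈ Set.Icc 0 T) : Integrable (g t) := by
  obtain ⟨B, hB⟩ := hg.bound
  refine (integrable_inv_one_add_sq.const_mul B).mono'
    (hg.cont.comp (Continuous.prodMk_right t)).aestronglyMeasurable (ae_of_all _ fun x => ?_)
  rw [Real.norm_eq_abs, ← div_eq_mul_inv, le_div_iff₀ (by positivity)]
  exact hB t ht x

theorem integrable_prod (hg : Decaying T g) :
    Integrable (Function.uncurry g) ((volume.restrict (Set.Ioc 0 T)).prod volume) := by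
  obtain ⟨B, hB⟩ := hg.bound
  have h1 : Integrable (fun z : ℝ × ℝ => B * (1 + z.2 ^ 2)⁻¹)
      ((volume.restrict (Set.Ioc 0 T)).prod volume) :=
    (integrable_const B).mul_prod integrable_inv_one_add_sq
  refine h1.mono' hg.cont.aestronglyMeasurable ?_
  have h2 : ∀ᵐ z : ℝ × ℝ ∂((volume.restrict (Set.Ioc 0 T)).prod volume), z.1 ∈ Set.Ioc 0 T :=
    Measure.quasiMeasurePreserving_fst.ae (ae_restrict_mem measurableSet_Ioc)
  filter_upwards [h2] with z hz
  rw [Real.norm_eq_abs, ← div_eq_mul_inv, le_div_iff₀ (by positivity)]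
  exact hB z.1 ⟨hz.1.le, hz.2⟩ z.2

theorem intervalIntegrable (hT : 0 ≤ T) (hg : Decaying T g) :
    IntervalIntegrable (fun t => ∫ x, g t x) volume 0 T :=
  (intervalIntegrable_iff_integrableOn_Ioc_of_le hT).2 hg.integrable_prod.integral_prod_left

theorem integral_mono (hT : 0 ≤ T) (hg : Decaying T g) (hh : Decaying T h)
    (hgh : ∀ t ∈ Set.Icc 0 T, ∀ x, g t x ≤ h t x) :
    ∫ t in (0 : ℝ)..T, ∫ x, g t x ≤ ∫ t in (0 : ℝ)..T, ∫ x, h t x := by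
  refine intervalIntegral.integral_mono_on hT (hg.intervalIntegrable hT)
    (hh.intervalIntegrable hT) fun t ht => ?_
  exact MeasureTheory.integral_mono (hg.integrable ht) (hh.integrable ht) (hgh t ht)

theorem integral_sub_eq (hT : 0 ≤ T) (hg : Decaying T g) (hh : Decaying T h) :
    ∫ t in (0 : ℝ)..T, ∫ x, (g t x - h t x) =
      (∫ t in (0 : ℝ)..T, ∫ x, g t x) - ∫ t in (0 : ℝ)..T, ∫ x, h t x := by
  rw [← intervalIntegral.integral_sub (hg.intervalIntegrable hT) (hh.intervalIntegrable hT)]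
  refine intervalIntegral.integral_congr fun t ht => ?_
  rw [Set.uIcc_of_le hT] at ht
  exact integral_sub (hg.integrable ht) (hh.integrable ht)

theorem integral_deriv_fst (hT : 0 ≤ T) (hg : Decaying T g) (hh : Decaying T h)
    (hgh : ∀ t ∈ Set.Icc 0 T, ∀ x, HasDerivAt (fun s => g s x) (h t x) t) :
    ∫ t in (0 : ℝ)..T, ∫ x, h t x = (∫ x, g T x) - ∫ x, g 0 x := by
  rw [intervalIntegral.integral_of_le hT, integral_integral_swap hh.integrable_prod,
    ← integral_sub (hg.integrable ⟨hT, le_rfl⟩) (hg.integrable ⟨le_rfl, hT⟩)]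
  congr 1
  ext x
  rw [← intervalIntegral.integral_of_le hT]
  refine intervalIntegral.integral_eq_sub_of_hasDerivAt (f := fun s => g s x) (fun t ht => ?_) ?_
  · rw [Set.uIcc_of_le hT] at ht
    exact hgh t ht x
  · exact (hh.cont.comp (Continuous.prodMk_left x)).intervalIntegrable _ _

theorem integral_deriv_snd (hT : 0 ≤ T) (hg : Decaying T g) (hh : Decaying T h)
    (hgh : ∀ t ∈ Set.Icc 0 T, ∀ x, HasDerivAt (g t) (h t x) x) :
    ∫ t in (0 : ℝ)..T, ∫ x, h t x = 0 := by
  rw [intervalIntegral.integral_congr (g := fun _ => (0 : ℝ)), intervalIntegral.integral_zero]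
  intro t ht
  rw [Set.uIcc_of_le hT] at ht
  exact integral_eq_zero_of_hasDerivAt_of_integrable (hgh t ht) (hh.integrable ht)
    (hg.integrable ht)

/-- The divergence theorem on `[0, T] × ℝ` for a current with density `n` and flux `-m`. -/
theorem integral_divergence (hT : 0 ≤ T) {n n' m m' J : ℝ → ℝ → ℝ} (hn : Decaying T n)
    (hn' : Decaying T n') (hm : Decaying T m) (hm' : Decaying T m')
    (hnd : ∀ t ∈ Set.Icc 0 T, ∀ x, HasDerivAt (fun s => n s x) (n' t x) t)
    (hmd : ∀ t ∈ Set.Icc 0 T, ∀ x, HasDerivAt (m t) (m' t x) x)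
    (hJ : ∀ t ∈ Set.Icc 0 T, ∀ x, J t x = m' t x - n' t x) :
    ∫ t in (0 : ℝ)..T, ∫ x, J t x = (∫ x, n 0 x) - ∫ x, n T x := by
  have : ∫ t in (0 : ℝ)..T, ∫ x, J t x = ∫ t in (0 : ℝ)..T, ∫ x, (m' t x - n' t x) := by
    refine intervalIntegral.integral_congr fun t ht => ?_
    rw [Set.uIcc_of_le hT] at ht
    exact congrArg _ (funext (hJ t ht))
  rw [this, integral_sub_eq hT hm' hn', integral_deriv_fst hT hn hn' hnd,
    integral_deriv_snd hT hm hm' hmd]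
  ring

end Decaying

/-- A function with decaying derivatives solving `∂ₜ²φ = ∂ₓ²φ - W φ` for times in `[0, T]`. -/
structure WaveSolution (T : ℝ) (W : ℝ → ℝ) (φ φt φx φtx φxx φtt : ℝ → ℝ → ℝ) : Prop where
  dec : Decaying T φ
  dec_t : Decaying T φt
  dec_x : Decaying T φx
  dec_tx : Decaying T φtx
  dec_xx : Decaying T φxx
  dec_tt : Decaying T φtt
  deriv_t : ∀ t x, HasDerivAt (fun s => φ s x) (φt t x) t
  deriv_x : ∀ t x, HasDerivAt (φ t) (φx t x) x
  deriv_tx : ∀ t x, HasDerivAt (fun s => φx s x) (φtx t x) t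
  deriv_xt : ∀ t x, HasDerivAt (φt t) (φtx t x) x
  deriv_xx : ∀ t x, HasDerivAt (φx t) (φxx t x) x
  deriv_tt : ∀ t x, HasDerivAt (fun s => φt s x) (φtt t x) t
  wave : ∀ t ∈ Set.Icc 0 T, ∀ x, φtt t x = φxx t x - W x * φ t x

namespace WaveSolution

variable {T : ℝ} {W w : ℝ → ℝ} {φ φt φx φtx φxx φtt : ℝ → ℝ → ℝ}

theorem dec_energy (S : WaveSolution T W φ φt φx φtx φxx φtt) (hW : Continuous W) {b : ℝ}
    (hb : ∀ x, |W x| ≤ b) :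
    Decaying T fun t x => φt t x ^ 2 + φx t x ^ 2 + W x * φ t x ^ 2 :=
  (S.dec_t.sq.add S.dec_x.sq).add (S.dec.sq.coeff_mul hW hb)

theorem energy_eq (S : WaveSolution T W φ φt φx φtx φxx φtt) (hT : 0 ≤ T) (hW : Continuous W)
    {b : ℝ} (hb : ∀ x, |W x| ≤ b) :
    ∫ x, (φt T x ^ 2 + φx T x ^ 2 + W x * φ T x ^ 2) =
      ∫ x, (φt 0 x ^ 2 + φx 0 x ^ 2 + W x * φ 0 x ^ 2) := by
  have h := Decaying.integral_divergence hT (J := fun _ _ => 0) (S.dec_energy hW hb)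
    (((S.dec_t.mul S.dec_tt).add (S.dec_x.mul S.dec_tx)).add
      ((S.dec.mul S.dec_t).coeff_mul hW hb) |>.const_mul 2)
    ((S.dec_t.mul S.dec_x).const_mul 2)
    (((S.dec_tx.mul S.dec_x).add (S.dec_t.mul S.dec_xx)).const_mul 2)
    (fun t _ x => ((((S.deriv_tt t x).fun_pow 2).fun_add ((S.deriv_tx t x).fun_pow 2)).fun_add
      (((S.deriv_t t x).fun_pow 2).const_mul (W x))).congr_deriv (by norm_num; ring))
    (fun t _ x => (((S.deriv_xt t x).fun_mul (S.deriv_xx t x)).const_mul 2))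
    (fun t ht x => by rw [S.wave t ht x]; ring)
  simp only [integral_zero, intervalIntegral.integral_zero] at h
  linarith

theorem morawetz_identity (S : WaveSolution T W φ φt φx φtx φxx φtt) (hT : 0 ≤ T) {b b' : ℝ}
    (hWd : ∀ x, HasDerivAt W (w x) x) (hw : Continuous w)
    (hb : ∀ x, |W x| ≤ b) (hb' : ∀ x, |w x| ≤ b') {c C : ℝ} (F : Multiplier w c C) :
    ∫ t in (0 : ℝ)..T, ∫ x, (F.f₁ x * φx t x ^ 2 + 2 * F.p x * φ t x * φx t x
      + (F.p₁ x - F.f x * w x / 2 - F.f₃ x / 4) * φ t x ^ 2) =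
    (∫ x, φt 0 x * (F.f x * φx 0 x + 1 / 2 * (F.f₁ x * φ 0 x))) -
      ∫ x, φt T x * (F.f x * φx T x + 1 / 2 * (F.f₁ x * φ T x)) := by
  have hW : Continuous W := continuous_iff_continuousAt.2 fun x => (hWd x).continuousAt
  have hf : Continuous F.f := continuous_iff_continuousAt.2 fun x => (F.hf x).continuousAt
  have hf₁ : Continuous F.f₁ := continuous_iff_continuousAt.2 fun x => (F.hf₁ x).continuousAt
  have hf₂ : Continuous F.f₂ := continuous_iff_continuousAt.2 fun x => (F.hf₂ x).continuousAt
  have hp : Continuous F.p := continuous_iff_continuousAt.2 fun x => (F.hp x).continuousAt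
  have hC : 0 ≤ C := (abs_nonneg _).trans (F.f_le 0)
  have hf₁C : ∀ x, |F.f₁ x| ≤ C := fun x =>
    (F.f₁_le x).trans (div_le_self hC (by nlinarith [sq_nonneg x]))
  have dn : Decaying T fun t x => φt t x * (F.f x * φx t x + 1 / 2 * (F.f₁ x * φ t x)) :=
    S.dec_t.mul ((S.dec_x.coeff_mul hf F.f_le).add ((S.dec.coeff_mul hf₁ hf₁C).const_mul (1 / 2)))
  have dn' : Decaying T fun t x => φtt t x * (F.f x * φx t x + 1 / 2 * (F.f₁ x * φ t x))
      + φt t x * (F.f x * φtx t x + 1 / 2 * (F.f₁ x * φt t x)) :=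
    (S.dec_tt.mul
      ((S.dec_x.coeff_mul hf F.f_le).add ((S.dec.coeff_mul hf₁ hf₁C).const_mul (1 / 2)))).add
    (S.dec_t.mul
      ((S.dec_tx.coeff_mul hf F.f_le).add ((S.dec_t.coeff_mul hf₁ hf₁C).const_mul (1 / 2))))
  have de : Decaying T fun t x => φx t x ^ 2 + φt t x ^ 2 - W x * φ t x ^ 2 :=
    (S.dec_x.sq.add S.dec_t.sq).sub (S.dec.sq.coeff_mul hW hb)
  have de' : Decaying T fun t x => 2 * (φx t x * φxx t x) + 2 * (φt t x * φtx t x)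
      - (w x * φ t x ^ 2 + W x * (2 * (φ t x * φx t x))) :=
    (((S.dec_x.mul S.dec_xx).const_mul 2).add ((S.dec_t.mul S.dec_tx).const_mul 2)).sub
      ((S.dec.sq.coeff_mul hw hb').add (((S.dec.mul S.dec_x).const_mul 2).coeff_mul hW hb))
  have dm : Decaying T fun t x => 1 / 2 * (F.f x * (φx t x ^ 2 + φt t x ^ 2 - W x * φ t x ^ 2))
      + 1 / 2 * (F.f₁ x * (φ t x * φx t x)) - 1 / 4 * (F.f₂ x * φ t x ^ 2) + F.p x * φ t x ^ 2 :=
    ((((de.coeff_mul hf F.f_le).const_mul (1 / 2)).add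
      (((S.dec.mul S.dec_x).coeff_mul hf₁ hf₁C).const_mul (1 / 2))).sub
      ((S.dec.sq.coeff_mul hf₂ F.f₂_le).const_mul (1 / 4))).add (S.dec.sq.coeff_mul hp F.p_le)
  have dm' : Decaying T fun t x =>
      1 / 2 * (F.f₁ x * (φx t x ^ 2 + φt t x ^ 2 - W x * φ t x ^ 2)
        + F.f x * (2 * (φx t x * φxx t x) + 2 * (φt t x * φtx t x)
          - (w x * φ t x ^ 2 + W x * (2 * (φ t x * φx t x)))))
      + 1 / 2 * (F.f₂ x * (φ t x * φx t x) + F.f₁ x * (φx t x * φx t x + φ t x * φxx t x))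
      - 1 / 4 * (F.f₃ x * φ t x ^ 2 + F.f₂ x * (2 * (φ t x * φx t x)))
      + (F.p₁ x * φ t x ^ 2 + F.p x * (2 * (φ t x * φx t x))) :=
    (((((de.coeff_mul hf₁ hf₁C).add (de'.coeff_mul hf F.f_le)).const_mul (1 / 2)).add
      ((((S.dec.mul S.dec_x).coeff_mul hf₂ F.f₂_le).add
        (((S.dec_x.mul S.dec_x).add (S.dec.mul S.dec_xx)).coeff_mul hf₁ hf₁C)).const_mul
          (1 / 2))).sub
      (((S.dec.sq.coeff_mul F.hf₃ F.f₃_le).add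
        (((S.dec.mul S.dec_x).const_mul 2).coeff_mul hf₂ F.f₂_le)).const_mul (1 / 4))).add
      ((S.dec.sq.coeff_mul F.hp₁ F.p₁_le).add
        (((S.dec.mul S.dec_x).const_mul 2).coeff_mul hp F.p_le))
  refine Decaying.integral_divergence hT dn dn' dm dm' (fun t _ x => ?_) (fun t _ x => ?_)
    fun t ht x => ?_
  · exact (S.deriv_tt t x).fun_mul (((S.deriv_tx t x).const_mul _).fun_add
      (((S.deriv_t t x).const_mul _).const_mul _))
  · have hsq := ((S.deriv_x t x).fun_pow 2)
    have he := ((((S.deriv_xx t x).fun_pow 2).fun_add ((S.deriv_xt t x).fun_pow 2)).fun_sub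
      ((hWd x).fun_mul hsq))
    refine ((((((F.hf x).fun_mul he).const_mul (1 / 2)).fun_add
      (((F.hf₁ x).fun_mul ((S.deriv_x t x).fun_mul (S.deriv_xx t x))).const_mul (1 / 2))).fun_sub
      (((F.hf₂ x).fun_mul hsq).const_mul (1 / 4))).fun_add ((F.hp x).fun_mul hsq)).congr_deriv ?_
    norm_num
    ring
  · rw [S.wave t ht x]
    ring

/-- A Hardy inequality, the zeroth order term being supplied by a potential bounded below near the
origin. -/
theorem hardy (S : WaveSolution T W φ φt φx φtx φxx φtt) (hW : Continuous W) {b H : ℝ}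
    (hb : ∀ x, |W x| ≤ b) (hW0 : ∀ x, 0 ≤ W x) (hH : 0 ≤ H)
    (hWH : ∀ x ∈ Set.Icc (-2 : ℝ) 2, 1 ≤ H * W x) {t : ℝ} (ht : t ∈ Set.Icc 0 T) :
    ∫ x, 1 / (1 + x ^ 2) ^ 2 * φ t x ^ 2 ≤ ∫ x, 2 * (φx t x ^ 2 + H * (W x * φ t x ^ 2)) := by
  set q : ℝ → ℝ := fun x => -x / (2 * (1 + x ^ 2)) with hq
  set q₁ : ℝ → ℝ := fun x => (x ^ 2 - 1) / (2 * (1 + x ^ 2) ^ 2) with hq₁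
  have hqd : ∀ x, HasDerivAt q (q₁ x) x := fun x => by
    have h2 : HasDerivAt (fun x : ℝ => 2 * (1 + x ^ 2)) (2 * (2 * x)) x :=
      (((hasDerivAt_pow 2 x).const_add 1).const_mul 2).congr_deriv (by norm_num)
    refine ((hasDerivAt_neg x).fun_div h2 (by positivity)).congr_deriv ?_
    simp only [hq₁]
    field_simp
    ring
  have hqc : Continuous q := continuous_iff_continuousAt.2 fun x => (hqd x).continuousAt
  have hq₁c : Continuous q₁ := (by fun_prop : Continuous fun x : ℝ => x ^ 2 - 1).div (by fun_prop)
    fun x => by positivity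
  have hqb : ∀ x, |q x| ≤ 1 := fun x => by
    simp only [hq]
    rw [abs_div, abs_of_pos (a := 2 * (1 + x ^ 2)) (by positivity), div_le_one (by positivity),
      abs_le]
    constructor <;> nlinarith [sq_nonneg (x - 1), sq_nonneg (x + 1)]
  have hq₁b : ∀ x, |q₁ x| ≤ 1 := fun x => by
    simp only [hq₁]
    rw [abs_div, abs_of_pos (a := 2 * (1 + x ^ 2) ^ 2) (by positivity), div_le_one (by positivity),
      abs_le]
    constructor <;> nlinarith [sq_nonneg x, sq_nonneg (x ^ 2)]
  have hkc : Continuous fun x : ℝ => 1 / (1 + x ^ 2) ^ 2 :=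
    continuous_const.div (by fun_prop) fun x => by positivity
  have hkb : ∀ x : ℝ, |1 / (1 + x ^ 2) ^ 2| ≤ 1 := fun x => by
    rw [abs_of_pos (by positivity), div_le_one (by positivity)]
    exact one_le_pow₀ (by nlinarith [sq_nonneg x])
  have dL : Decaying T fun t x => 1 / (1 + x ^ 2) ^ 2 * φ t x ^ 2 := S.dec.sq.coeff_mul hkc hkb
  have dR : Decaying T fun t x => 2 * (φx t x ^ 2 + H * (W x * φ t x ^ 2)) :=
    (S.dec_x.sq.add ((S.dec.sq.coeff_mul hW hb).const_mul H)).const_mul 2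
  have dQ : Decaying T fun t x => q x * φ t x ^ 2 := S.dec.sq.coeff_mul hqc hqb
  have dQ' : Decaying T fun t x => q₁ x * φ t x ^ 2 + q x * (2 * (φ t x * φx t x)) :=
    (S.dec.sq.coeff_mul hq₁c hq₁b).add (((S.dec.mul S.dec_x).const_mul 2).coeff_mul hqc hqb)
  have hz : ∫ x, (q₁ x * φ t x ^ 2 + q x * (2 * (φ t x * φx t x))) = 0 :=
    integral_eq_zero_of_hasDerivAt_of_integrable
      (fun x => ((hqd x).fun_mul ((S.deriv_x t x).fun_pow 2)).congr_deriv (by push_cast; ring))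
      (dQ'.integrable ht) (dQ.integrable ht)
  have hsum := integral_add (dR.integrable ht) ((dQ'.const_mul 2).integrable ht)
  rw [integral_const_mul 2 fun x => q₁ x * φ t x ^ 2 + q x * (2 * (φ t x * φx t x)), hz, mul_zero, add_zero] at hsum
  rw [← hsum]
  refine integral_mono (dL.integrable ht) ((dR.add (dQ'.const_mul 2)).integrable ht) fun x => ?_
  have hpos : 0 ≤ (φx t x + q x * φ t x) ^ 2 := sq_nonneg _
  have hcoef : 1 / 2 * (1 / (1 + x ^ 2) ^ 2) ≤ q₁ x - q x ^ 2 + H * W x := by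
    have e : q₁ x - q x ^ 2 = (x ^ 2 / 4 - 1 / 2) * (1 / (1 + x ^ 2) ^ 2) := by
      simp only [hq, hq₁]
      field_simp
      ring
    rw [e]
    have hk0 : 0 < 1 / (1 + x ^ 2) ^ 2 := by positivity
    have hk1 := (abs_le.1 (hkb x)).2
    have hHW : 0 ≤ H * W x := mul_nonneg hH (hW0 x)
    by_cases hx : x ∈ Set.Icc (-2 : ℝ) 2
    · nlinarith [hWH x hx, mul_nonneg (sq_nonneg x) hk0.le]
    · have : 4 ≤ x ^ 2 := by
        by_contra! h
        exact hx ⟨by nlinarith, by nlinarith⟩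
      nlinarith
  have := mul_le_mul_of_nonneg_right hcoef (sq_nonneg (φ t x))
  simp only
  nlinarith

theorem abs_integral_current_le (S : WaveSolution T W φ φt φx φtx φxx φtt) (hW : Continuous W)
    {b H c C : ℝ} (hb : ∀ x, |W x| ≤ b) (hW0 : ∀ x, 0 ≤ W x) (hH : 0 ≤ H)
    (hWH : ∀ x ∈ Set.Icc (-2 : ℝ) 2, 1 ≤ H * W x) (F : Multiplier w c C) {t : ℝ}
    (ht : t ∈ Set.Icc 0 T) :
    |∫ x, φt t x * (F.f x * φx t x + 1 / 2 * (F.f₁ x * φ t x))| ≤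
      (1 + 2 * C ^ 2 + C ^ 2 * H) * ∫ x, (φt t x ^ 2 + φx t x ^ 2 + W x * φ t x ^ 2) := by
  have hC : 0 ≤ C := (abs_nonneg _).trans (F.f_le 0)
  have hkc : Continuous fun x : ℝ => 1 / (1 + x ^ 2) ^ 2 :=
    continuous_const.div (by fun_prop) fun x => by positivity
  have hkb : ∀ x : ℝ, |1 / (1 + x ^ 2) ^ 2| ≤ 1 := fun x => by
    rw [abs_of_pos (by positivity), div_le_one (by positivity)]
    exact one_le_pow₀ (by nlinarith [sq_nonneg x])
  have dL : Decaying T fun t x => 1 / (1 + x ^ 2) ^ 2 * φ t x ^ 2 := S.dec.sq.coeff_mul hkc hkb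
  have dR : Decaying T fun t x => 2 * (φx t x ^ 2 + H * (W x * φ t x ^ 2)) :=
    (S.dec_x.sq.add ((S.dec.sq.coeff_mul hW hb).const_mul H)).const_mul 2
  have dK : Decaying T fun t x => φt t x ^ 2 + C ^ 2 * φx t x ^ 2 :=
    S.dec_t.sq.add (S.dec_x.sq.const_mul (C ^ 2))
  have hardy := S.hardy hW hb hW0 hH hWH ht
  have h1 : |∫ x, φt t x * (F.f x * φx t x + 1 / 2 * (F.f₁ x * φ t x))| ≤
      ∫ x, (φt t x ^ 2 + C ^ 2 * φx t x ^ 2 + C ^ 2 / 4 * (1 / (1 + x ^ 2) ^ 2 * φ t x ^ 2)) := by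
    rw [← Real.norm_eq_abs]
    refine norm_integral_le_of_norm_le ((dK.add (dL.const_mul _)).integrable ht)
      (ae_of_all _ fun x => ?_)
    have hf2 : (F.f x * φx t x) ^ 2 ≤ C ^ 2 * φx t x ^ 2 := by
      rw [mul_pow, ← sq_abs (F.f x)]
      have := F.f_le x
      gcongr
    have hf12 : (F.f₁ x * φ t x) ^ 2 ≤ C ^ 2 * (1 / (1 + x ^ 2) ^ 2 * φ t x ^ 2) := by
      rw [mul_pow, ← sq_abs (F.f₁ x)]
      have := F.f₁_le x
      calc _ ≤ (C / (1 + x ^ 2)) ^ 2 * φ t x ^ 2 := by gcongr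
        _ = _ := by field_simp
    rw [Real.norm_eq_abs, abs_le]
    generalize F.f x * φx t x = P at *
    generalize F.f₁ x * φ t x = Q at *
    constructor <;> nlinarith [sq_nonneg (φt t x - (P + 1 / 2 * Q)),
      sq_nonneg (φt t x + (P + 1 / 2 * Q)), sq_nonneg (P - 1 / 2 * Q)]
  rw [integral_add (dK.integrable ht) ((dL.const_mul _).integrable ht), integral_const_mul] at h1
  have h2 : C ^ 2 / 4 * ∫ x, 1 / (1 + x ^ 2) ^ 2 * φ t x ^ 2 ≤
      C ^ 2 / 4 * ∫ x, 2 * (φx t x ^ 2 + H * (W x * φ t x ^ 2)) := by gcongr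
  rw [← integral_const_mul (C ^ 2 / 4) (fun x => 2 * (φx t x ^ 2 + H * (W x * φ t x ^ 2)))] at h2
  rw [← integral_const_mul]
  refine h1.trans ((add_le_add_right h2 _).trans ?_)
  rw [← integral_add (dK.integrable ht) ((dR.const_mul _).integrable ht)]
  refine integral_mono ((dK.add (dR.const_mul _)).integrable ht)
    (((S.dec_energy hW hb).const_mul _).integrable ht) fun x => ?_
  have hx := sq_nonneg (φx t x)
  have ht := sq_nonneg (φt t x)
  have hw := mul_nonneg (hW0 x) (sq_nonneg (φ t x))
  have hC2 := sq_nonneg C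
  have hCH := mul_nonneg hC2 hH
  simp only
  nlinarith [mul_nonneg hC2 hx, mul_nonneg hC2 ht, mul_nonneg hC2 hw, mul_nonneg hCH hx,
    mul_nonneg hCH ht, mul_nonneg hCH hw]

theorem local_decay (S : WaveSolution T W φ φt φx φtx φxx φtt) (hT : 0 ≤ T)
    {b b' H c C : ℝ} (hWd : ∀ x, HasDerivAt W (w x) x) (hw : Continuous w)
    (hb : ∀ x, |W x| ≤ b) (hb' : ∀ x, |w x| ≤ b') (hW0 : ∀ x, 0 ≤ W x) (hH : 0 ≤ H)
    (hWH : ∀ x ∈ Set.Icc (-2 : ℝ) 2, 1 ≤ H * W x) (hc : 0 < c) (F : Multiplier w c C) :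
    ∫ t in (0 : ℝ)..T, ∫ x, (φ t x ^ 2 / (1 + x ^ 2) ^ 2 + φx t x ^ 2 / (1 + x ^ 2)) ≤
      (4 * (1 + 2 * C ^ 2 + C ^ 2 * H) / c) *
        (1 / 2 * ∫ x, (φt 0 x ^ 2 + φx 0 x ^ 2 + W x * φ 0 x ^ 2)) := by
  have hW : Continuous W := continuous_iff_continuousAt.2 fun x => (hWd x).continuousAt
  have hf : Continuous F.f := continuous_iff_continuousAt.2 fun x => (F.hf x).continuousAt
  have hf₁ : Continuous F.f₁ := continuous_iff_continuousAt.2 fun x => (F.hf₁ x).continuousAt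
  have hp : Continuous F.p := continuous_iff_continuousAt.2 fun x => (F.hp x).continuousAt
  have hC : 0 ≤ C := (abs_nonneg _).trans (F.f_le 0)
  have hf₁C : ∀ x, |F.f₁ x| ≤ C := fun x =>
    (F.f₁_le x).trans (div_le_self hC (by nlinarith [sq_nonneg x]))
  have hk (m : ℕ) : Continuous fun x : ℝ => 1 / (1 + x ^ 2) ^ m :=
    continuous_const.div (by fun_prop) fun x => by positivity
  have hkb (m : ℕ) (x : ℝ) : |1 / (1 + x ^ 2) ^ m| ≤ 1 := by
    rw [abs_of_pos (by positivity), div_le_one (by positivity)]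
    exact one_le_pow₀ (by nlinarith [sq_nonneg x])
  have dD : Decaying T fun t x =>
      c * (φ t x ^ 2 / (1 + x ^ 2) ^ 2 + φx t x ^ 2 / (1 + x ^ 2)) := by
    have := ((S.dec.sq.coeff_mul (hk 2) (hkb 2)).add
      (S.dec_x.sq.coeff_mul (hk 1) (hkb 1))).const_mul c
    simpa only [one_div_mul_eq_div, pow_one] using this
  have dJ : Decaying T fun t x => F.f₁ x * φx t x ^ 2 + 2 * F.p x * φ t x * φx t x
      + (F.p₁ x - F.f x * w x / 2 - F.f₃ x / 4) * φ t x ^ 2 := by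
    have h : Decaying T fun t x => F.f₁ x * φx t x ^ 2 + 2 * (F.p x * (φ t x * φx t x))
      + (F.p₁ x * φ t x ^ 2 - 1 / 2 * (F.f x * (w x * φ t x ^ 2))
        - 1 / 4 * (F.f₃ x * φ t x ^ 2)) :=
      ((S.dec_x.sq.coeff_mul hf₁ hf₁C).add
        (((S.dec.mul S.dec_x).coeff_mul hp F.p_le).const_mul 2)).add
        (((S.dec.sq.coeff_mul F.hp₁ F.p₁_le).sub
          (((S.dec.sq.coeff_mul hw hb').coeff_mul hf F.f_le).const_mul (1 / 2))).sub
          ((S.dec.sq.coeff_mul F.hf₃ F.f₃_le).const_mul (1 / 4)))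
    convert h using 3
    ring
  have hmono := dD.integral_mono hT dJ fun t _ x => F.lower x (φ t x) (φx t x)
  rw [S.morawetz_identity hT hWd hw hb hb' F] at hmono
  simp only [integral_const_mul, intervalIntegral.integral_const_mul] at hmono
  have h0 := S.abs_integral_current_le hW hb hW0 hH hWH F ⟨le_rfl, hT⟩
  have hTT := S.abs_integral_current_le hW hb hW0 hH hWH F ⟨hT, le_rfl⟩
  rw [S.energy_eq hT hW hb] at hTT
  rw [div_mul_eq_mul_div, le_div_iff₀ hc, mul_comm _ c]
  refine hmono.trans ?_
  linarith [(abs_le.1 h0).2, (abs_le.1 hTT).1]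

end WaveSolution

theorem decaying_of_forall_pow {T : ℝ} {g : ℝ → ℝ → ℝ} (hg : Continuous (Function.uncurry g))
    (h : ∀ k : ℕ, ∃ B, ∀ t ∈ Set.Icc 0 T, ∀ x, |x| ^ k * |g t x| ≤ B) : Decaying T g := by
  obtain ⟨B₀, h₀⟩ := h 0
  obtain ⟨B₂, h₂⟩ := h 2
  refine ⟨hg, B₀ + B₂, fun t ht x => ?_⟩
  have e₀ := h₀ t ht x
  have e₂ := h₂ t ht x
  rw [pow_zero, one_mul] at e₀
  rw [sq_abs] at e₂
  linarith

theorem waveSolution_of_schwartz {T : ℝ} {W : ℝ → ℝ} {φ : ℝ → ℝ → ℝ}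
    (hφ : ContDiff ℝ (⊤ : ℕ∞) (Function.uncurry φ))
    (hdec : ∀ (i j k : ℕ) (t₀ t₁ : ℝ), ∃ B : ℝ, ∀ t ∈ Set.Icc t₀ t₁, ∀ x : ℝ,
      |x| ^ k * |iteratedDeriv i (fun s : ℝ => iteratedDeriv j (φ s) x) t| ≤ B)
    (hwave : ∀ t ∈ Set.Icc (0 : ℝ) T, ∀ x : ℝ,
      iteratedDeriv 2 (fun s : ℝ => φ s x) t = iteratedDeriv 2 (φ t) x - W x * φ t x) :
    WaveSolution T W φ (fun t x => deriv (fun s => φ s x) t) (fun t x => deriv (φ t) x)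
      (fun t x => deriv (fun s => deriv (φ s) x) t) (fun t x => deriv (fun y => deriv (φ t) y) x)
      (fun t x => deriv (fun s => deriv (fun r => φ r x) s) t) := by
  have ht := contDiff_deriv_fst hφ
  have hx := contDiff_deriv_snd hφ
  have htx := contDiff_deriv_fst hx
  have hxx := contDiff_deriv_snd hx
  have htt := contDiff_deriv_fst ht
  refine ⟨decaying_of_forall_pow hφ.continuous fun k => ?_,
    decaying_of_forall_pow ht.continuous fun k => ?_,
    decaying_of_forall_pow hx.continuous fun k => ?_,
    decaying_of_forall_pow htx.continuous fun k => ?_,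
    decaying_of_forall_pow hxx.continuous fun k => ?_,
    decaying_of_forall_pow htt.continuous fun k => ?_,
    hasDerivAt_fst hφ, hasDerivAt_snd hφ, hasDerivAt_fst hx, fun t x => ?_, hasDerivAt_snd hx,
    hasDerivAt_fst ht, fun t ht x => ?_⟩
  · simpa using hdec 0 0 k 0 T
  · simpa using hdec 1 0 k 0 T
  · simpa using hdec 0 1 k 0 T
  · simpa using hdec 1 1 k 0 T
  · simpa [iteratedDeriv_succ] using hdec 0 2 k 0 T
  · simpa [iteratedDeriv_succ] using hdec 2 0 k 0 T
  · rw [← deriv_comm hφ t x]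
    exact hasDerivAt_snd ht t x
  · simpa [iteratedDeriv_succ] using hwave t ht x

theorem exists_pos_lower_bound {g : ℝ → ℝ} {a b : ℝ} (hg : Continuous g)
    (hpos : ∀ x ∈ Set.Icc a b, 0 < g x) : ∃ c, 0 < c ∧ ∀ x ∈ Set.Icc a b, c ≤ g x := by
  rcases (Set.Icc a b).eq_empty_or_nonempty with h | h
  · exact ⟨1, one_pos, by simp [h]⟩
  · obtain ⟨x₀, hx₀, hmin⟩ := isCompact_Icc.exists_isMinOn h hg.continuousOn
    exact ⟨g x₀, hpos x₀ hx₀, fun x hx => hmin hx⟩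

/-- Fix `M > 0`.  There exists a constant `C > 0` such that for
every `l ∈ ℕ` (with `λ = l(l+1)`), every `T > 0`, and every smooth function
`φ : [0,T] × ℝ → ℝ` which solves the wave equation
`∂_t²φ = ∂_x²φ − W_λ·φ` and is, together with all its derivatives, Schwartz in
`x` locally uniformly in `t`, the local decay estimate
`∫_0^T ∫ (φ²/(1+x²)² + (∂_xφ)²/(1+x²)) dx dt ≤ C·E`
holds, where `E = (1/2)∫ ((∂_tφ(0))² + (∂_xφ(0))² + W_λ·φ(0)²) dx` is the initial
energy; `C` is independent of `l`, `T` and `φ`.  Here `W_λ(x) = V_λ(ρ(x))` with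
`ρ` the inverse of the tortoise coordinate. -/
theorem local_decay_estimate_schwarzschild (M : ℝ) (hM : 0 < M)
    (ρ : ℝ → ℝ) (hρ1 : ∀ x : ℝ, 2 * M < ρ x)
    (hρ2 : ∀ x : ℝ,
      ρ x + 2 * M * Real.log ((ρ x - 2 * M) / (2 * M)) - 3 * M + 2 * M * Real.log 2 = x) :
    ∃ C : ℝ, 0 < C ∧ ∀ (l : ℕ) (T : ℝ), 0 < T → ∀ (φ : ℝ → ℝ → ℝ)
      (W : ℝ → ℝ),
      (∀ x : ℝ, W x = (1 - 2 * M / ρ x) *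
          (2 * M / (ρ x) ^ 3 + ((l : ℝ) * ((l : ℝ) + 1)) / (ρ x) ^ 2)) →
      ContDiff ℝ (⊤ : ℕ∞) (Function.uncurry φ) →
      (∀ (i j k : ℕ) (t₀ t₁ : ℝ), ∃ B : ℝ, ∀ t ∈ Set.Icc t₀ t₁, ∀ x : ℝ,
        |x| ^ k * |iteratedDeriv i (fun s : ℝ => iteratedDeriv j (φ s) x) t| ≤ B) →
      (∀ t ∈ Set.Icc (0 : ℝ) T, ∀ x : ℝ,
        iteratedDeriv 2 (fun s : ℝ => φ s x) t
          = iteratedDeriv 2 (φ t) x - W x * φ t x) →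
      (∫ t in (0 : ℝ)..T, ∫ x : ℝ,
          ((φ t x) ^ 2 / (1 + x ^ 2) ^ 2 + (deriv (φ t) x) ^ 2 / (1 + x ^ 2)))
        ≤ C * ((1 / 2) * ∫ x : ℝ,
            ((deriv (fun s : ℝ => φ s x) 0) ^ 2 + (deriv (φ 0) x) ^ 2
              + W x * (φ 0 x) ^ 2)) := by
  have hρ2' : ∀ x, tortoise M (ρ x) = x := hρ2
  have hρ0 : ∀ x, 0 < ρ x := fun x => by linarith [hρ1 x]
  have hmono := tortoise_inverse_strictMono hM hρ1 hρ2'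
  have hρd := hasDerivAt_tortoise_inverse hM hρ1 hρ2'
  have hρc : Continuous ρ := continuous_iff_continuousAt.2 fun x => (hρd x).continuousAt
  have hρt {r : ℝ} (hr : 2 * M < r) : ρ (tortoise M r) = r :=
    tortoise_inverse_apply hM hρ1 hρ2' hr
  have hVd (lam x : ℝ) := hasDerivAt_potential (lam := lam) (hρd x) (hρ0 x).ne'
  have hVc (lam : ℝ) : Continuous fun x => potential M lam (ρ x) :=
    continuous_iff_continuousAt.2 fun x => (hVd lam x).continuousAt
  have hwc (lam : ℝ) : Continuous fun x => potentialDeriv M lam (ρ x) := by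
    unfold potentialDeriv
    have h0 : ∀ x, ρ x ≠ 0 := fun x => (hρ0 x).ne'
    fun_prop (disch := intro x; exact pow_ne_zero _ (h0 x))
  have hd : ∀ x, 0 < 1 - 2 * M / ρ x := fun x => by
    rw [sub_pos, div_lt_one (hρ0 x)]; exact hρ1 x
  set A := tortoise M (8 / 3 * M)
  set B := tortoise M (3 * M)
  have hρA : ρ A = 8 / 3 * M := hρt (by linarith)
  have hρB : ρ B = 3 * M := hρt (by linarith)
  have hAB : A ≤ B := by rw [← hmono.le_iff_le, hρA, hρB]; linarith
  obtain ⟨c₁, hc₁, h₁⟩ := exists_pos_lower_bound (a := B + 1) (b := B + 2) (hwc 0).neg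
    fun x hx => by
      have : ρ B < ρ x := hmono (by linarith [hx.1])
      exact neg_pos.2 (potentialDeriv_zero_neg hM (by linarith))
  obtain ⟨c₂, hc₂, h₂⟩ := exists_pos_lower_bound (a := A - 2) (b := A - 1) (hwc 0)
    fun x hx => by
      have : ρ x < ρ A := hmono (by linarith [hx.2])
      exact potentialDeriv_zero_pos hM (hρ1 x) (by linarith)
  obtain ⟨c₃, hc₃, h₃⟩ := exists_pos_lower_bound (a := -2) (b := 2) (hVc 0) fun x _ => by
    have := hd x
    have := hρ0 x
    unfold potential
    positivity
  obtain ⟨c, C, hc, hC, hmult⟩ := exists_multiplier hAB (lt_min hc₁ hc₂)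
  refine ⟨4 * (1 + 2 * C ^ 2 + C ^ 2 * (1 / c₃)) / c, by positivity,
    fun l T hT φ W hW hφ hdec hwave => ?_⟩
  set lam : ℝ := l * (l + 1)
  have hl : 0 ≤ lam := by positivity
  obtain rfl : W = fun x => potential M lam (ρ x) := funext hW
  obtain ⟨r₀, hr₀, hpeak⟩ := exists_potential_peak hM hl
  have hρr₀ : ρ (tortoise M r₀) = r₀ := hρt (by linarith [hr₀.1])
  obtain ⟨K, hK⟩ := exists_abs_potentialDeriv_le hM hl
  obtain ⟨F⟩ := hmult (tortoise M r₀)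
    ⟨by rw [← hmono.le_iff_le, hρr₀, hρA]; exact hr₀.1,
      by rw [← hmono.le_iff_le, hρr₀, hρB]; exact hr₀.2⟩
    (fun x => potentialDeriv M lam (ρ x))
    (fun x => by
      have hx := hpeak (ρ x) (hρ1 x)
      rcases lt_trichotomy x (tortoise M r₀) with h | h | h
      · have : ρ x < r₀ := hρr₀ ▸ hmono h
        exact mul_nonpos_of_nonpos_of_nonneg (by linarith)
          (nonneg_of_mul_nonpos_right hx (by linarith))
      · simp [h]
      · have : r₀ < ρ x := hρr₀ ▸ hmono h
        exact mul_nonpos_of_nonneg_of_nonpos (by linarith)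
          (nonpos_of_mul_nonpos_right hx (by linarith)))
    (fun x hx => by
      have : ρ B < ρ x := hmono (by linarith [hx.1])
      refine (min_le_left _ _).trans ((h₁ x hx).trans ?_)
      exact neg_le_neg (potentialDeriv_anti hM hl (by linarith)))
    (fun x hx => by
      have : ρ x < ρ A := hmono (by linarith [hx.2])
      refine (min_le_right _ _).trans ((h₂ x hx).trans ?_)
      exact potentialDeriv_mono hM hl (hρ1 x) (by linarith))
  have hV0 : ∀ x, potential M 0 (ρ x) ≤ potential M lam (ρ x) := fun x => by
    have := (hd x).le
    unfold potential
    gcongr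
  refine (waveSolution_of_schwartz hφ hdec hwave).local_decay hT.le (hVd lam) (hwc lam)
    (fun x => abs_potential_le hM hl (hρ1 x)) (fun x => hK _ (hρ1 x)) (fun x => ?_)
    (by positivity) (fun x hx => ?_) hc F
  · have := hd x
    have := hρ0 x
    unfold potential
    positivity
  · rw [one_div_mul_eq_div, one_le_div hc₃]
    exact (h₃ x hx).trans (hV0 x)
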